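/- (Conformal null case, description of T(Z).) Let Z ∈ (ℝⁿ)* be a nonzero row covector with ⟨Z,Z⟩ = 0. A column vector X ∈ ℝⁿ satisfies both ⁅⁅ι₊(Z), ι₋(X)⁆, ι₋(X)⁆ = −2 ι₋(X) and ⁅⁅ι₊(Z), ι₋(X)⁆, ι₊(Z)⁆ = 2 ι₊(Z) if and only if Z⬝X = 1 and ⟨X,X⟩ = 0. -/

import Mathlib

open Matrix

/-- Index type for (n+2)×(n+2) block matrices with blocks of sizes 1, n, 1. -/
abbrev Idx (n : ℕ) := Unit ⊕ Fin n ⊕ Unit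

/-- The diagonal entries of the signature matrix I = diag(Id_p, −Id_q). -/
def sig (p q : ℕ) : Fin (p + q) → ℝ := fun i => if (i : ℕ) < p then 1 else -1

/-- The n×n signature matrix I = diag(Id_p, −Id_q). -/
def sigMat (p q : ℕ) : Matrix (Fin (p + q)) (Fin (p + q)) ℝ := Matrix.diagonal (sig p q)

/-- The inner product of signature (p,q): ⟨X,Y⟩ = Xᵀ I Y (the same formula gives
Z I Wᵀ for row covectors). -/
def form (p q : ℕ) (X Y : Fin (p + q) → ℝ) : ℝ := ∑ i, X i * sig p q i * Y i

/-- The column vector I Zᵀ associated to a row covector Z (written `starr`) (equally, the row covector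
Xᵀ I associated to a column vector X). -/
def iFlip (p q : ℕ) (Z : Fin (p + q) → ℝ) : Fin (p + q) → ℝ := fun i => sig p q i * Z i

/-- Embedding of g₋₁ ≅ ℝⁿ into so(p+1,q+1): (2,1)-block X, (3,2)-block −XᵀI. -/
def iotaMinus (p q : ℕ) (X : Fin (p + q) → ℝ) : Matrix (Idx (p + q)) (Idx (p + q)) ℝ :=
  Matrix.of fun i j =>
    match i, j with
    | Sum.inr (Sum.inl i), Sum.inl _ => X i
    | Sum.inr (Sum.inr _), Sum.inr (Sum.inl j) => -(X j * sig p q j)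
    | _, _ => 0

/-- Embedding of g₁ ≅ (ℝⁿ)* into so(p+1,q+1): (1,2)-block Z, (2,3)-block −IZᵀ. -/
def iotaPlus (p q : ℕ) (Z : Fin (p + q) → ℝ) : Matrix (Idx (p + q)) (Idx (p + q)) ℝ :=
  Matrix.of fun i j =>
    match i, j with
    | Sum.inl _, Sum.inr (Sum.inl j) => Z j
    | Sum.inr (Sum.inl i), Sum.inr (Sum.inr _) => -(sig p q i * Z i)
    | _, _ => 0

/-- Embedding of g₀ into so(p+1,q+1): block diagonal matrix diag(a, A, −a). -/
def iotaZero (p q : ℕ) (A : Matrix (Fin (p + q)) (Fin (p + q)) ℝ) (a : ℝ) :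
    Matrix (Idx (p + q)) (Idx (p + q)) ℝ :=
  Matrix.of fun i j =>
    match i, j with
    | Sum.inl _, Sum.inl _ => a
    | Sum.inr (Sum.inl i), Sum.inr (Sum.inl j) => A i j
    | Sum.inr (Sum.inr _), Sum.inr (Sum.inr _) => -a
    | _, _ => 0

lemma sig_mul_self (p q : ℕ) (i : Fin (p + q)) : sig p q i * sig p q i = 1 := by
  unfold sig; split_ifs <;> norm_num

/-- The bracket g₁ × g₋₁ → g₀. -/
lemma lie_iotaPlus_iotaMinus (p q : ℕ) (Z X : Fin (p + q) → ℝ) :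
    ⁅iotaPlus p q Z, iotaMinus p q X⁆ =
      iotaZero p q (vecMulVec (iFlip p q Z) (iFlip p q X) - vecMulVec X Z) (Z ⬝ᵥ X) := by
  rw [Ring.lie_def]
  ext (i | i | i) (j | j | j) <;>
    simp [Matrix.mul_apply, iotaPlus, iotaMinus, iotaZero, iFlip, vecMulVec_apply, dotProduct]
  · simp [mul_comm]
  · refine Finset.sum_congr rfl fun k _ => ?_
    linear_combination X k * Z k * sig_mul_self p q k

/-- The bracket g₀ × g₋₁ → g₋₁. -/
lemma lie_iotaZero_iotaMinus (p q : ℕ) (A : Matrix (Fin (p + q)) (Fin (p + q)) ℝ) (a : ℝ)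
    (hA : ∀ i j, sig p q i * A i j = -(sig p q j * A j i)) (X : Fin (p + q) → ℝ) :
    ⁅iotaZero p q A a, iotaMinus p q X⁆ = iotaMinus p q (A *ᵥ X - a • X) := by
  rw [Ring.lie_def]
  ext (i | i | i) (j | j | j) <;>
    simp [Matrix.mul_apply, iotaMinus, iotaZero, mulVec, dotProduct]
  · ring
  · have h : ∑ k, X k * sig p q k * A k j = -((∑ k, A j k * X k) * sig p q j) := by
      rw [Finset.sum_mul, ← Finset.sum_neg_distrib]
      refine Finset.sum_congr rfl fun k _ => ?_
      linear_combination X k * hA k j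
    linear_combination h

/-- The bracket g₀ × g₁ → g₁. -/
lemma lie_iotaZero_iotaPlus (p q : ℕ) (A : Matrix (Fin (p + q)) (Fin (p + q)) ℝ) (a : ℝ)
    (hA : ∀ i j, sig p q i * A i j = -(sig p q j * A j i)) (Z : Fin (p + q) → ℝ) :
    ⁅iotaZero p q A a, iotaPlus p q Z⁆ = iotaPlus p q (a • Z - Z ᵥ* A) := by
  rw [Ring.lie_def]
  ext (i | i | i) (j | j | j) <;>
    simp [Matrix.mul_apply, iotaPlus, iotaZero, vecMul, dotProduct]
  have h : ∑ k, A i k * (sig p q k * Z k) = -(sig p q i * ∑ k, Z k * A k i) := by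
    rw [Finset.mul_sum, ← Finset.sum_neg_distrib]
    refine Finset.sum_congr rfl fun k _ => ?_
    linear_combination sig p q i * sig p q k * Z k * hA i k - A i k * sig p q k * Z k * sig_mul_self p q i
      - sig p q i * Z k * A k i * sig_mul_self p q k
  linear_combination -h

lemma iotaMinus_injective (p q : ℕ) : Function.Injective (iotaMinus p q) := fun _ _ h =>
  funext fun i => congr_fun (congr_fun h (.inr (.inl i))) (.inl ())

lemma iotaPlus_injective (p q : ℕ) : Function.Injective (iotaPlus p q) := fun _ _ h =>
  funext fun i => congr_fun (congr_fun h (.inl ())) (.inr (.inl i))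

lemma smul_iotaMinus (p q : ℕ) (c : ℝ) (X : Fin (p + q) → ℝ) :
    c • iotaMinus p q X = iotaMinus p q (c • X) := by
  ext (i | i | i) (j | j | j) <;> simp [iotaMinus, mul_assoc]

lemma smul_iotaPlus (p q : ℕ) (c : ℝ) (Z : Fin (p + q) → ℝ) :
    c • iotaPlus p q Z = iotaPlus p q (c • Z) := by
  ext (i | i | i) (j | j | j) <;> simp [iotaPlus, mul_left_comm]

lemma iFlip_dotProduct (p q : ℕ) (X Y : Fin (p + q) → ℝ) :
    iFlip p q X ⬝ᵥ Y = form p q X Y :=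
  Finset.sum_congr rfl fun i _ => by simp only [iFlip]; ring

lemma dotProduct_iFlip (p q : ℕ) (X Y : Fin (p + q) → ℝ) :
    X ⬝ᵥ iFlip p q Y = form p q X Y :=
  Finset.sum_congr rfl fun i _ => by simp only [iFlip]; ring

lemma iFlip_ne_zero (p q : ℕ) {Z : Fin (p + q) → ℝ} (hZ : Z ≠ 0) : iFlip p q Z ≠ 0 := by
  contrapose! hZ
  funext i
  have hs : sig p q i ≠ 0 := left_ne_zero_of_mul_eq_one (sig_mul_self p q i)
  exact (mul_eq_zero.mp (congr_fun hZ i)).resolve_left hs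

/-- The endomorphism part of ⁅ι₊(Z), ι₋(X)⁆ is skew for the form of signature (p,q). -/
lemma sig_mul_vecMulVec_sub_skew (p q : ℕ) (Z X : Fin (p + q) → ℝ) (i j : Fin (p + q)) :
    sig p q i * (vecMulVec (iFlip p q Z) (iFlip p q X) - vecMulVec X Z) i j =
      -(sig p q j * (vecMulVec (iFlip p q Z) (iFlip p q X) - vecMulVec X Z) j i) := by
  simp only [Matrix.sub_apply, vecMulVec_apply, iFlip]
  linear_combination Z i * sig p q j * X j * sig_mul_self p q i + Z j * sig p q i * X i * sig_mul_self p q j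

lemma lie_lie_iotaPlus_iotaMinus_iotaMinus (p q : ℕ) (Z X : Fin (p + q) → ℝ) :
    ⁅⁅iotaPlus p q Z, iotaMinus p q X⁆, iotaMinus p q X⁆ =
      iotaMinus p q (form p q X X • iFlip p q Z - (2 * (Z ⬝ᵥ X)) • X) := by
  rw [lie_iotaPlus_iotaMinus,
    lie_iotaZero_iotaMinus p q _ _ (sig_mul_vecMulVec_sub_skew p q Z X),
    sub_mulVec, vecMulVec_mulVec, vecMulVec_mulVec, iFlip_dotProduct]
  congr 1
  ext i
  simp
  ring

lemma lie_lie_iotaPlus_iotaMinus_iotaPlus (p q : ℕ) (Z X : Fin (p + q) → ℝ) :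
    ⁅⁅iotaPlus p q Z, iotaMinus p q X⁆, iotaPlus p q Z⁆ =
      iotaPlus p q ((2 * (Z ⬝ᵥ X)) • Z - form p q Z Z • iFlip p q X) := by
  rw [lie_iotaPlus_iotaMinus,
    lie_iotaZero_iotaPlus p q _ _ (sig_mul_vecMulVec_sub_skew p q Z X),
    vecMul_sub, vecMul_vecMulVec, vecMul_vecMulVec, dotProduct_iFlip]
  congr 1
  ext i
  simp
  ring

/-- Conformal null case, description of T(Z): for Z ≠ 0 with ⟨Z,Z⟩ = 0,
⁅⁅ι₊(Z), ι₋(X)⁆, ι₋(X)⁆ = −2ι₋(X) and ⁅⁅ι₊(Z), ι₋(X)⁆, ι₊(Z)⁆ = 2ι₊(Z)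
iff Z⬝X = 1 and ⟨X,X⟩ = 0. -/
theorem conformal_null_TZ (p q : ℕ) (hn : 3 ≤ p + q) (Z : Fin (p + q) → ℝ)
    (hZ : Z ≠ 0) (hnull : form p q Z Z = 0) (X : Fin (p + q) → ℝ) :
    (⁅⁅iotaPlus p q Z, iotaMinus p q X⁆, iotaMinus p q X⁆ = (-2 : ℝ) • iotaMinus p q X ∧
     ⁅⁅iotaPlus p q Z, iotaMinus p q X⁆, iotaPlus p q Z⁆ = (2 : ℝ) • iotaPlus p q Z) ↔
    ((∑ i, Z i * X i) = 1 ∧ form p q X X = 0) := by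
  change _ ↔ (Z ⬝ᵥ X = 1 ∧ _)
  rw [lie_lie_iotaPlus_iotaMinus_iotaMinus, lie_lie_iotaPlus_iotaMinus_iotaPlus, smul_iotaMinus,
    smul_iotaPlus, (iotaMinus_injective p q).eq_iff, (iotaPlus_injective p q).eq_iff, hnull,
    zero_smul, sub_zero, (smul_left_injective ℝ hZ).eq_iff]
  constructor
  · rintro ⟨hX, hs⟩
    have hs' : Z ⬝ᵥ X = 1 := by linarith
    refine ⟨hs', ?_⟩
    rw [hs', mul_one, neg_smul, sub_eq_neg_self] at hX
    exact (smul_eq_zero.mp hX).resolve_right (iFlip_ne_zero p q hZ)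
  · rintro ⟨hs, hX⟩
    simp [hs, hX]
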